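/- Chordal graphs satisfy the Triangle Condition: in a connected chordal graph G, for any vertex v₀ and any edge vv' with d(v₀,v)=d(v₀,v')=k≥1, there exists a vertex u with d(v₀,u)=k−1 adjacent to both v and v'. -/

import Mathlib

/-- A graph is chordal if every cycle of length at least 4 has a chord, i.e. an edge of the
graph between two vertices of the cycle that is not an edge of the cycle. -/
def IsChordalGraph {V : Type*} (G : SimpleGraph V) : Prop :=
  ∀ (v : V) (c : G.Walk v v), c.IsCycle → 4 ≤ c.length →
    ∃ u w : V, u ∈ c.support ∧ w ∈ c.support ∧ G.Adj u w ∧ s(u, w) ∉ c.edges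

/-- In a chordal graph, if the endpoints of a walk avoiding the adjacent vertices `v` and `v'` are
adjacent to `v` and `v'` respectively, then some vertex of the walk is adjacent to both. -/
theorem IsChordalGraph.exists_mem_support_adj_adj {V : Type*} {G : SimpleGraph V}
    (hG : IsChordalGraph G) {v v' : V} (hvv : G.Adj v v') {x y : V} (p : G.Walk x y)
    (hx : G.Adj v x) (hy : G.Adj v' y) (hv : v ∉ p.support) (hv' : v' ∉ p.support) :
    ∃ u ∈ p.support, G.Adj u v ∧ G.Adj u v' := by
  classical
  induction hn : p.length using Nat.strong_induction_on generalizing x y with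
  | _ n ih =>
  subst hn
  have shorten : ∀ {x' y' : V} (q : G.Walk x' y'), q.support ⊆ p.support →
      q.length < p.length → G.Adj v x' → G.Adj v' y' →
      ∃ u ∈ p.support, G.Adj u v ∧ G.Adj u v' := by
    intro x' y' q hq hl hx' hy'
    obtain ⟨u, hu, h⟩ := ih _ hl q hx' hy' (fun h => hv (hq h)) (fun h => hv' (hq h)) rfl
    exact ⟨u, hq hu, h⟩
  by_cases hp : p.IsPath
  swap
  · refine shorten p.bypass p.support_bypass_subset_support ?_ hx hy
    refine lt_of_le_of_ne p.length_bypass_le_length fun h => hp ?_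
    rw [← p.bypass_eq_self_of_length_le_length_bypass h.ge]
    exact p.bypass_isPath
  rcases Nat.eq_zero_or_pos p.length with h0 | hpos
  · obtain rfl := SimpleGraph.Walk.eq_of_length_eq_zero h0
    exact ⟨x, p.start_mem_support, hx.symm, hy.symm⟩
  have hcyc : (SimpleGraph.Walk.cons hvv.symm
      (SimpleGraph.Walk.cons hx (p.concat hy.symm))).IsCycle := by
    rw [SimpleGraph.Walk.cons_isCycle_iff]
    constructor
    · rw [SimpleGraph.Walk.cons_isPath_iff]
      refine ⟨hp.concat hv' hy.symm, ?_⟩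
      simp [SimpleGraph.Walk.support_concat, hv, hvv.ne]
    · have h1 : v' ≠ x := fun h => hv' (h ▸ p.start_mem_support)
      have h2 : v ≠ y := fun h => hv (h ▸ p.end_mem_support)
      have h3 : s(v', v) ∉ p.edges := fun h => hv' (p.fst_mem_support_of_mem_edges h)
      simp [SimpleGraph.Walk.edges_concat, h1, h2, h3, hvv.ne, hvv.ne']
  obtain ⟨a, b, ha, hb, hab, he⟩ := hG _ _ hcyc (by simp; omega)
  have chord_left : ∀ w ∈ p.support, G.Adj v w → w ≠ x →
      ∃ u ∈ p.support, G.Adj u v ∧ G.Adj u v' := by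
    intro w hw hvw hne
    exact shorten (p.dropUntil w hw) (p.support_dropUntil_subset_support hw)
      (SimpleGraph.Walk.length_dropUntil_lt_length hw hne) hvw hy
  have chord_right : ∀ w ∈ p.support, G.Adj v' w → w ≠ y →
      ∃ u ∈ p.support, G.Adj u v ∧ G.Adj u v' := by
    intro w hw hvw hne
    exact shorten (p.takeUntil w hw) (p.support_takeUntil_subset_support hw)
      (SimpleGraph.Walk.length_takeUntil_lt_length hw hne) hx hvw
  have chord_inner : ∀ i j, i < j → j ≤ p.length → G.Adj (p.getVert i) (p.getVert j) →
      s(p.getVert i, p.getVert j) ∉ p.edges →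
      ∃ u ∈ p.support, G.Adj u v ∧ G.Adj u v' := by
    intro i j hij hj hadj hne
    have hij' : i + 1 ≠ j := by
      rintro rfl
      exact hne (p.mk_mem_edges_iff_exists.2 ⟨i, by omega, rfl⟩)
    refine shorten ((p.take i).append (SimpleGraph.Walk.cons hadj (p.drop j))) ?_ ?_ hx hy
    · intro z hz
      rw [SimpleGraph.Walk.mem_support_append_iff, SimpleGraph.Walk.support_cons,
        List.mem_cons] at hz
      rcases hz with hz | rfl | hz
      · exact (p.isSubwalk_take i).support_subset hz
      · exact p.getVert_mem_support i
      · exact (p.isSubwalk_drop j).support_subset hz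
    · rw [SimpleGraph.Walk.length_append, SimpleGraph.Walk.length_cons,
        SimpleGraph.Walk.take_length, SimpleGraph.Walk.drop_length]
      omega
  simp only [SimpleGraph.Walk.support_cons, SimpleGraph.Walk.support_concat, List.mem_cons,
    List.concat_eq_append, List.mem_append, List.not_mem_nil, or_false,
    SimpleGraph.Walk.edges_cons, SimpleGraph.Walk.edges_concat, not_or] at ha hb he
  obtain ⟨he1, he2, he3, he4⟩ := he
  have ha' : a = v ∨ a = v' ∨ a ∈ p.support := by tauto
  have hb' : b = v ∨ b = v' ∨ b ∈ p.support := by tauto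
  rcases ha' with rfl | rfl | ha' <;> rcases hb' with rfl | rfl | hb'
  · exact absurd rfl hab.ne
  · exact absurd Sym2.eq_swap he1
  · exact chord_left b hb' hab (by rintro rfl; exact he2 rfl)
  · exact absurd rfl he1
  · exact absurd rfl hab.ne
  · exact chord_right b hb' hab (by rintro rfl; exact he4 Sym2.eq_swap)
  · exact chord_left a ha' hab.symm (by rintro rfl; exact he2 Sym2.eq_swap)
  · exact chord_right a ha' hab.symm (by rintro rfl; exact he4 rfl)
  · obtain ⟨i, rfl, hi⟩ := SimpleGraph.Walk.mem_support_iff_exists_getVert.1 ha'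
    obtain ⟨j, rfl, hj⟩ := SimpleGraph.Walk.mem_support_iff_exists_getVert.1 hb'
    rcases lt_trichotomy i j with h | rfl | h
    · exact chord_inner i j h hj hab he3
    · exact absurd rfl hab.ne
    · exact chord_inner j i h hi hab.symm (by rwa [Sym2.eq_swap])

/-- A vertex at positive distance `k` from `v₀` has a neighbour joined to `v₀` by a walk
all of whose vertices are at distance less than `k` from `v₀`. -/
theorem SimpleGraph.Connected.exists_adj_walk_dist_lt {V : Type*} {G : SimpleGraph V}
    (hG : G.Connected) {v₀ v : V} (h : 1 ≤ G.dist v₀ v) :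
    ∃ (x : V) (p : G.Walk x v₀), G.Adj v x ∧
      ∀ w ∈ p.support, G.dist v₀ w < G.dist v₀ v := by
  classical
  obtain ⟨p, hp⟩ := hG.exists_walk_length_eq_dist v v₀
  rw [SimpleGraph.dist_comm] at hp
  cases p with
  | nil => simp at h
  | @cons _ x _ hadj q =>
    refine ⟨x, q, hadj, fun w hw => ?_⟩
    have h1 := SimpleGraph.dist_le (q.dropUntil w hw)
    have h2 := q.length_dropUntil_le_length hw
    rw [SimpleGraph.dist_comm] at h1
    rw [SimpleGraph.Walk.length_cons] at hp
    omega

theorem stmt1 {V : Type*} (G : SimpleGraph V) (hconn : G.Connected)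
    (hchordal : IsChordalGraph G) (v₀ : V) :
    ∀ (v v' : V) (k : ℕ), G.Adj v v' → G.dist v₀ v = k → G.dist v₀ v' = k → 1 ≤ k →
      ∃ u : V, G.dist v₀ u = k - 1 ∧ G.Adj u v ∧ G.Adj u v' := by
  intro v v' k hvv hv hv' hk
  obtain ⟨x, p, hx, hp⟩ := hconn.exists_adj_walk_dist_lt (v₀ := v₀) (v := v) (by omega)
  obtain ⟨y, q, hy, hq⟩ := hconn.exists_adj_walk_dist_lt (v₀ := v₀) (v := v') (by omega)
  have hlt : ∀ w ∈ (p.append q.reverse).support, G.dist v₀ w < k := by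
    intro w hw
    rw [SimpleGraph.Walk.mem_support_append_iff, SimpleGraph.Walk.support_reverse,
      List.mem_reverse] at hw
    rcases hw with hw | hw
    · exact hv ▸ hp w hw
    · exact hv' ▸ hq w hw
  obtain ⟨u, hu, huv, huv'⟩ := hchordal.exists_mem_support_adj_adj hvv (p.append q.reverse) hx hy
    (fun h => (hlt v h).ne hv) (fun h => (hlt v' h).ne hv')
  refine ⟨u, ?_, huv, huv'⟩
  have h1 := hconn.dist_triangle (u := v₀) (v := u) (w := v)
  have h2 : G.dist u v = 1 := SimpleGraph.dist_eq_one_iff_adj.2 huv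
  have h3 := hlt u hu
  omega
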